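/- arXiv:2008.07472 — 3 statements merged into one kernel-verified Lean document; each statement's English description precedes it below -/
import Mathlib

section
/- Let T : ℋⁿ → ℋⁿ be an ℝ-linear positive map. Then for every nonzero projection P ∈ ℋⁿ and every involution ε ∈ ℋⁿ, λ(|T(P∘ε)|) ≺_w λ(T(I)); consequently, w-sup{λ(|T(P∘ε)|) : P a nonzero projection, ε an involution} = λ(T(I)). -/
open Matrix
open scoped ComplexOrder

/-- Sum of the `k` largest entries of `p` (as a supremum of sums over `k`-subsets). -/
noncomputable def sumLargest {n : ℕ} (p : Fin n → ℝ) (k : ℕ) : ℝ :=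
  sSup ((fun A : Finset (Fin n) => ∑ i ∈ A, p i) '' {A : Finset (Fin n) | A.card = k})

/-- `p` is weakly majorized by `q`. -/
def WeakMaj {n : ℕ} (p q : Fin n → ℝ) : Prop :=
  ∀ k : ℕ, 1 ≤ k → k ≤ n → sumLargest p k ≤ sumLargest q k

/-- `p` is majorized by `q`. -/
def Maj {n : ℕ} (p q : Fin n → ℝ) : Prop :=
  WeakMaj p q ∧ ∑ i, p i = ∑ i, q i

/-- `p` has nonnegative entries arranged in decreasing order. -/
def DecrNonneg {n : ℕ} (p : Fin n → ℝ) : Prop :=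
  Antitone p ∧ ∀ i, 0 ≤ p i

/-- The decreasing rearrangement of a vector. -/
noncomputable def decrRearrange {n : ℕ} (p : Fin n → ℝ) : Fin n → ℝ :=
  fun i => p (Tuple.sort p (Fin.rev i))

/-- `x` is the supremum of `S` in the weak-majorization order (w-sup). -/
def IsWSup {n : ℕ} (S : Set (Fin n → ℝ)) (x : Fin n → ℝ) : Prop :=
  DecrNonneg x ∧ (∀ s ∈ S, WeakMaj s x) ∧
    ∀ p : Fin n → ℝ, (∀ i, 0 ≤ p i) → (∀ s ∈ S, WeakMaj s p) → WeakMaj x p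

/-- `x` is the infimum of `Q` in the weak-majorization order (w-inf). -/
def IsWInf {n : ℕ} (Q : Set (Fin n → ℝ)) (x : Fin n → ℝ) : Prop :=
  DecrNonneg x ∧ (∀ q ∈ Q, WeakMaj x q) ∧
    ∀ p : Fin n → ℝ, (∀ i, 0 ≤ p i) → (∀ q ∈ Q, WeakMaj p q) → WeakMaj p x

open Classical in
/-- The vector of eigenvalues of a Hermitian matrix, in decreasing order
(junk value `0` if the matrix is not Hermitian). -/
noncomputable def specVec {n : ℕ} (X : Matrix (Fin n) (Fin n) ℂ) : Fin n → ℝ :=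
  if h : X.IsHermitian then decrRearrange h.eigenvalues else 0

open Classical in
/-- `λ(|X|)`: the absolute values of the eigenvalues of a Hermitian matrix `X`,
in decreasing order. -/
noncomputable def absSpecVec {n : ℕ} (X : Matrix (Fin n) (Fin n) ℂ) : Fin n → ℝ :=
  if h : X.IsHermitian then decrRearrange (fun i => |h.eigenvalues i|) else 0

/-- The Jordan product `X ∘ Y = (XY + YX)/2`. -/
noncomputable def jmul {n : ℕ} (X Y : Matrix (Fin n) (Fin n) ℂ) : Matrix (Fin n) (Fin n) ℂ :=
  (2 : ℂ)⁻¹ • (X * Y + Y * X)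

/-- A nonzero (orthogonal) projection in `ℋⁿ`. -/
def IsProjection {n : ℕ} (P : Matrix (Fin n) (Fin n) ℂ) : Prop :=
  P.IsHermitian ∧ P * P = P ∧ P ≠ 0

/-- An involution in `ℋⁿ`: a Hermitian matrix with `ε² = I`. -/
def IsInvolution {n : ℕ} (ε : Matrix (Fin n) (Fin n) ℂ) : Prop :=
  ε.IsHermitian ∧ ε * ε = 1

/-- A positive map: maps positive semidefinite matrices to positive semidefinite matrices. -/
def PositiveMap {n : ℕ} (T : Matrix (Fin n) (Fin n) ℂ → Matrix (Fin n) (Fin n) ℂ) : Prop :=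
  ∀ X : Matrix (Fin n) (Fin n) ℂ, X.PosSemidef → (T X).PosSemidef

/-- `S` is the adjoint of `T` with respect to the trace inner product on `ℋⁿ`. -/
def IsAdjointOf {n : ℕ} (S T : Matrix (Fin n) (Fin n) ℂ → Matrix (Fin n) (Fin n) ℂ) : Prop :=
  ∀ X Y : Matrix (Fin n) (Fin n) ℂ, X.IsHermitian → Y.IsHermitian →
    Matrix.trace (T X * Y) = Matrix.trace (X * S Y)

/-- `q` is the least vector of `T`: `λ(|T(X)|) ≺_w q * λ(|X|)` for all Hermitian `X`,
and `q ≺_w q'` for any other `q' ∈ (ℝⁿ₊)↓` with the same property. -/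
def IsLeastVector {n : ℕ} (T : Matrix (Fin n) (Fin n) ℂ → Matrix (Fin n) (Fin n) ℂ)
    (q : Fin n → ℝ) : Prop :=
  DecrNonneg q ∧
  (∀ X : Matrix (Fin n) (Fin n) ℂ, X.IsHermitian →
    WeakMaj (absSpecVec (T X)) (q * absSpecVec X)) ∧
  ∀ q' : Fin n → ℝ, DecrNonneg q' →
    (∀ X : Matrix (Fin n) (Fin n) ℂ, X.IsHermitian →
      WeakMaj (absSpecVec (T X)) (q' * absSpecVec X)) → WeakMaj q q'

lemma sum_le_sumLargest {n : ℕ} (p : Fin n → ℝ) (A : Finset (Fin n)) :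
    ∑ i ∈ A, p i ≤ sumLargest p A.card :=
  le_csSup ((Set.toFinite _).image _).bddAbove ⟨A, rfl, rfl⟩

lemma sumLargest_le {n k : ℕ} (hk : k ≤ n) {p : Fin n → ℝ} {c : ℝ}
    (h : ∀ A : Finset (Fin n), A.card = k → ∑ i ∈ A, p i ≤ c) : sumLargest p k ≤ c := by
  obtain ⟨A, -, hA⟩ := Finset.exists_subset_card_eq
    (s := (Finset.univ : Finset (Fin n))) (n := k) (by simpa using hk)
  refine csSup_le ⟨_, A, hA, rfl⟩ ?_
  rintro _ ⟨A, hA, rfl⟩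
  exact h A hA

lemma sumLargest_comp_perm_le {n k : ℕ} (hk : k ≤ n) (p : Fin n → ℝ)
    (σ : Equiv.Perm (Fin n)) : sumLargest (p ∘ σ) k ≤ sumLargest p k := by
  refine sumLargest_le hk fun A hA => ?_
  have h := sum_le_sumLargest p (A.map σ.toEmbedding)
  rw [Finset.card_map, hA, Finset.sum_map] at h
  exact h

lemma sumLargest_comp_perm {n k : ℕ} (hk : k ≤ n) (p : Fin n → ℝ)
    (σ : Equiv.Perm (Fin n)) : sumLargest (p ∘ σ) k = sumLargest p k := by
  refine le_antisymm (sumLargest_comp_perm_le hk p σ) ?_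
  have h := sumLargest_comp_perm_le hk (p ∘ σ) σ⁻¹
  rwa [show (p ∘ σ) ∘ ⇑σ⁻¹ = p from funext fun i => by simp] at h

lemma sumLargest_decrRearrange {n k : ℕ} (hk : k ≤ n) (p : Fin n → ℝ) :
    sumLargest (decrRearrange p) k = sumLargest p k :=
  sumLargest_comp_perm hk p (Fin.revPerm.trans (Tuple.sort p))

lemma antitone_decrRearrange {n : ℕ} (p : Fin n → ℝ) : Antitone (decrRearrange p) :=
  fun _ _ hij => Tuple.monotone_sort p (Fin.rev_le_rev.mpr hij)

/-- A `k`-subset attaining the sum of the `k` largest entries, together with a threshold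
separating the entries inside from those outside. -/
lemma exists_threshold {n k : ℕ} (hk : k ≤ n) (p : Fin n → ℝ) :
    ∃ (A : Finset (Fin n)) (t : ℝ), A.card = k ∧ (∀ i ∈ A, t ≤ p i) ∧ ∀ j ∉ A, p j ≤ t := by
  obtain ⟨A, hA, hmax⟩ := Finset.exists_max_image
    (Finset.powersetCard k (Finset.univ : Finset (Fin n))) (fun A => ∑ i ∈ A, p i)
    (Finset.powersetCard_nonempty.mpr (by simpa using hk))
  have hcard : A.card = k := (Finset.mem_powersetCard.mp hA).2
  have hexch : ∀ i ∈ A, ∀ j ∉ A, p j ≤ p i := by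
    intro i hi j hj
    have hj' : j ∉ A.erase i := fun h => hj (Finset.mem_of_mem_erase h)
    have h := hmax (insert j (A.erase i)) (by
      have := Finset.card_erase_add_one hi
      simp [Finset.mem_powersetCard, Finset.card_insert_of_notMem hj']
      omega)
    rw [Finset.sum_insert hj', ← Finset.add_sum_erase A p hi] at h
    linarith
  rcases A.eq_empty_or_nonempty with rfl | hne
  · obtain ⟨t, ht⟩ := (Set.finite_range p).bddAbove
    exact ⟨∅, t, hcard, by simp, fun j _ => ht ⟨j, rfl⟩⟩
  · obtain ⟨i, hi, hmin⟩ := Finset.exists_min_image A p hne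
    exact ⟨A, p i, hcard, hmin, hexch i hi⟩

lemma sum_mul_le_sumLargest {n k : ℕ} (hk : k ≤ n) (p w : Fin n → ℝ)
    (hw0 : ∀ i, 0 ≤ w i) (hw1 : ∀ i, w i ≤ 1) (hw : ∑ i, w i = k) :
    ∑ i, w i * p i ≤ sumLargest p k := by
  obtain ⟨A, t, hA, hin, hout⟩ := exists_threshold hk p
  subst hA
  refine le_trans ?_ (sum_le_sumLargest p A)
  have h : ∑ i, w i * (p i - t) ≤ ∑ i, if i ∈ A then p i - t else 0 := by
    refine Finset.sum_le_sum fun i _ => ?_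
    split_ifs with hi
    · exact mul_le_of_le_one_left (sub_nonneg.mpr (hin i hi)) (hw1 i)
    · exact mul_nonpos_of_nonneg_of_nonpos (hw0 i) (sub_nonpos.mpr (hout i hi))
  simp only [mul_sub, Finset.sum_sub_distrib, ← Finset.sum_mul, hw, Finset.sum_ite_mem,
    Finset.univ_inter, Finset.sum_const, nsmul_eq_mul] at h
  linarith

lemma sum_normSq_row {n : ℕ} {W : Matrix (Fin n) (Fin n) ℂ} (hW : W * Wᴴ = 1) (i : Fin n) :
    ∑ j, Complex.normSq (W i j) = 1 := by
  have h := congrFun (congrFun hW i) i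
  simp only [mul_apply, conjTranspose_apply, one_apply_eq, Complex.star_def,
    Complex.mul_conj] at h
  exact_mod_cast h

lemma sum_normSq_col {n : ℕ} {W : Matrix (Fin n) (Fin n) ℂ} (hW : Wᴴ * W = 1) (j : Fin n) :
    ∑ i, Complex.normSq (W i j) = 1 := by
  have h := sum_normSq_row (W := Wᴴ) (by simpa using hW) j
  simpa [conjTranspose_apply, Complex.normSq_conj] using h

lemma Matrix.IsHermitian.star_eigenvectorUnitary_mul_mul {n : ℕ}
    {X : Matrix (Fin n) (Fin n) ℂ} (hX : X.IsHermitian) :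
    (hX.eigenvectorUnitary : Matrix (Fin n) (Fin n) ℂ)ᴴ * X * hX.eigenvectorUnitary =
      diagonal (fun i => (hX.eigenvalues i : ℂ)) := by
  have h := hX.conjStarAlgAut_star_eigenvectorUnitary
  rw [Unitary.conjStarAlgAut_star_apply] at h
  exact h

/-- Ky Fan's inequality: diagonal entries in an orthonormal basis are dominated by the
largest eigenvalues. -/
lemma sum_diag_le_sumLargest_eigenvalues {n : ℕ} {B U : Matrix (Fin n) (Fin n) ℂ}
    (hB : B.IsHermitian) (hU : U ∈ unitaryGroup (Fin n) ℂ) (A : Finset (Fin n)) :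
    ∑ i ∈ A, ((Uᴴ * B * U) i i).re ≤ sumLargest hB.eigenvalues A.card := by
  set V : Matrix (Fin n) (Fin n) ℂ := hB.eigenvectorUnitary.1 with hV
  set W := Uᴴ * V with hWdef
  have hVm : V ∈ unitaryGroup (Fin n) ℂ := hB.eigenvectorUnitary.2
  have hWm : W ∈ unitaryGroup (Fin n) ℂ := mul_mem (Unitary.star_mem hU) hVm
  have hW1 : W * Wᴴ = 1 := mem_unitaryGroup_iff.mp hWm
  have hW2 : Wᴴ * W = 1 := mem_unitaryGroup_iff'.mp hWm
  have hVV : V * Vᴴ = 1 := mem_unitaryGroup_iff.mp hVm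
  have hconj : Uᴴ * B * U = W * diagonal (fun i => (hB.eigenvalues i : ℂ)) * Wᴴ := by
    rw [← hB.star_eigenvectorUnitary_mul_mul, ← hV, hWdef, conjTranspose_mul,
      conjTranspose_conjTranspose]
    calc Uᴴ * B * U = Uᴴ * 1 * B * 1 * U := by simp
      _ = _ := by rw [← hVV]; simp only [Matrix.mul_assoc]
  have hdiag : ∀ i, ((Uᴴ * B * U) i i).re =
      ∑ j, Complex.normSq (W i j) * hB.eigenvalues j := by
    intro i
    rw [hconj, mul_apply, Complex.re_sum]
    refine Finset.sum_congr rfl fun j _ => ?_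
    rw [mul_diagonal, conjTranspose_apply, mul_right_comm, Complex.star_def, Complex.mul_conj, ← Complex.ofReal_mul,
      Complex.ofReal_re]
  simp only [hdiag]
  rw [Finset.sum_comm]
  simp only [← Finset.sum_mul]
  refine sum_mul_le_sumLargest (card_finset_fin_le A) _ _
    (fun j => Finset.sum_nonneg fun i _ => Complex.normSq_nonneg _) (fun j => ?_) ?_
  · rw [← sum_normSq_col hW2 j]
    exact Finset.sum_le_sum_of_subset_of_nonneg (Finset.subset_univ A)
      fun i _ _ => Complex.normSq_nonneg _
  · rw [Finset.sum_comm]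
    simp [sum_normSq_row hW1]

lemma weakMaj_absSpecVec_specVec {n : ℕ} {X B : Matrix (Fin n) (Fin n) ℂ}
    (hX : X.IsHermitian) (hB : B.IsHermitian) (hsub : (B - X).PosSemidef)
    (hadd : (B + X).PosSemidef) : WeakMaj (absSpecVec X) (specVec B) := by
  intro k _ hk
  rw [absSpecVec, dif_pos hX, specVec, dif_pos hB, sumLargest_decrRearrange hk,
    sumLargest_decrRearrange hk]
  refine sumLargest_le hk fun A hA => ?_
  subst hA
  refine le_trans (Finset.sum_le_sum fun i _ => ?_)
    (sum_diag_le_sumLargest_eigenvalues hB hX.eigenvectorUnitary.2 A)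
  set U : Matrix (Fin n) (Fin n) ℂ := hX.eigenvectorUnitary.1 with hU
  have h1 := (Complex.nonneg_iff.mp
    ((hsub.conjTranspose_mul_mul_same U).diag_nonneg (i := i))).1
  have h2 := (Complex.nonneg_iff.mp
    ((hadd.conjTranspose_mul_mul_same U).diag_nonneg (i := i))).1
  have hUX := hX.star_eigenvectorUnitary_mul_mul
  rw [← hU] at hUX
  rw [Matrix.mul_sub, Matrix.sub_mul, hUX, Matrix.sub_apply, diagonal_apply_eq,
    Complex.sub_re, Complex.ofReal_re] at h1
  rw [Matrix.mul_add, Matrix.add_mul, hUX, Matrix.add_apply, diagonal_apply_eq,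
    Complex.add_re, Complex.ofReal_re] at h2
  exact abs_le.mpr ⟨by linarith, by linarith⟩

lemma Matrix.IsHermitian.posSemidef_mul_self {n : ℕ} {A : Matrix (Fin n) (Fin n) ℂ}
    (hA : A.IsHermitian) : (A * A).PosSemidef := by
  simpa only [hA.eq] using posSemidef_conjTranspose_mul_self A

lemma IsInvolution.neg {n : ℕ} {ε : Matrix (Fin n) (Fin n) ℂ} (hε : IsInvolution ε) :
    IsInvolution (-ε) :=
  ⟨hε.1.neg, by rw [neg_mul_neg, hε.2]⟩

lemma posSemidef_one_sub_jmul {n : ℕ} {P ε : Matrix (Fin n) (Fin n) ℂ}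
    (hP : IsProjection P) (hε : IsInvolution ε) : (1 - jmul P ε).PosSemidef := by
  have h : 1 - jmul P ε = (2 : ℂ)⁻¹ • ((P - ε) * (P - ε) + (1 - P) * (1 - P)) := by
    have hexp : (P - ε) * (P - ε) + (1 - P) * (1 - P) =
        (2 : ℂ) • (1 : Matrix (Fin n) (Fin n) ℂ) - (P * ε + ε * P) := by
      simp only [sub_mul, mul_sub, hP.2.1, hε.2, one_mul, mul_one, two_smul]
      abel
    rw [hexp, smul_sub, smul_smul, inv_mul_cancel₀ two_ne_zero, one_smul, jmul]
  rw [h]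
  exact ((hP.1.sub hε.1).posSemidef_mul_self.add
    (isHermitian_one.sub hP.1).posSemidef_mul_self).smul (by positivity)

lemma jmul_neg {n : ℕ} (X Y : Matrix (Fin n) (Fin n) ℂ) : jmul X (-Y) = -jmul X Y := by
  simp only [jmul, mul_neg, neg_mul, ← neg_add, smul_neg]

lemma absSpecVec_eq_specVec {n : ℕ} {X : Matrix (Fin n) (Fin n) ℂ} (hX : X.PosSemidef) :
    absSpecVec X = specVec X := by
  rw [absSpecVec, dif_pos hX.1, specVec, dif_pos hX.1]
  simp only [abs_of_nonneg (hX.eigenvalues_nonneg _)]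

lemma decrNonneg_specVec {n : ℕ} {X : Matrix (Fin n) (Fin n) ℂ} (hX : X.PosSemidef) :
    DecrNonneg (specVec X) := by
  rw [specVec, dif_pos hX.1]
  exact ⟨antitone_decrRearrange _, fun i => hX.eigenvalues_nonneg _⟩

lemma weakMaj_of_positive {n : ℕ} {T : Matrix (Fin n) (Fin n) ℂ → Matrix (Fin n) (Fin n) ℂ}
    (hTlin : IsLinearMap ℝ T) (hTpos : PositiveMap T) {P ε : Matrix (Fin n) (Fin n) ℂ}
    (hP : IsProjection P) (hε : IsInvolution ε) :
    WeakMaj (absSpecVec (T (jmul P ε))) (specVec (T 1)) := by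
  have hsub := hTpos _ (posSemidef_one_sub_jmul hP hε)
  have hadd := hTpos _ (posSemidef_one_sub_jmul hP hε.neg)
  rw [jmul_neg, sub_neg_eq_add, hTlin.map_add] at hadd
  rw [hTlin.map_sub] at hsub
  have hone : (T 1).IsHermitian := (hTpos 1 PosSemidef.one).1
  have hX : (T (jmul P ε)).IsHermitian := by simpa using hadd.1.sub hone
  exact weakMaj_absSpecVec_specVec hX hone hsub hadd

theorem wsup_lambda_of_positive (n : ℕ) (hn : 0 < n) (T : Matrix (Fin n) (Fin n) ℂ → Matrix (Fin n) (Fin n) ℂ)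
    (hTlin : IsLinearMap ℝ T) (hTpos : PositiveMap T) :
    (∀ P ε : Matrix (Fin n) (Fin n) ℂ, IsProjection P → IsInvolution ε →
      WeakMaj (absSpecVec (T (jmul P ε))) (specVec (T 1))) ∧
    IsWSup {s | ∃ P ε : Matrix (Fin n) (Fin n) ℂ, IsProjection P ∧ IsInvolution ε ∧
      s = absSpecVec (T (jmul P ε))} (specVec (T 1)) := by
  have : Nonempty (Fin n) := ⟨⟨0, hn⟩⟩
  have hmaj : ∀ P ε : Matrix (Fin n) (Fin n) ℂ, IsProjection P → IsInvolution ε →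
      WeakMaj (absSpecVec (T (jmul P ε))) (specVec (T 1)) :=
    fun _ _ hP hε => weakMaj_of_positive hTlin hTpos hP hε
  have hone : (T 1).PosSemidef := hTpos 1 PosSemidef.one
  refine ⟨hmaj, decrNonneg_specVec hone, ?_, fun p _ hp => ?_⟩
  · rintro _ ⟨P, ε, hP, hε, rfl⟩
    exact hmaj P ε hP hε
  · refine hp _ ⟨1, 1, ⟨isHermitian_one, one_mul 1, one_ne_zero⟩,
      ⟨isHermitian_one, one_mul 1⟩, ?_⟩
    have hjmul : jmul (1 : Matrix (Fin n) (Fin n) ℂ) 1 = 1 := by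
      rw [jmul, one_mul, ← two_smul ℂ, smul_smul, inv_mul_cancel₀ two_ne_zero, one_smul]
    rw [hjmul, absSpecVec_eq_specVec hone]
end

section
/- Let B ∈ ℋⁿ be such that tr(XB) = ⟨λ(X), λ(B)⟩ for all X ∈ ℋⁿ (that is, B strongly operator commutes with every element of ℋⁿ). Then B = tI for some t ∈ ℝ. -/
open Matrix
open scoped ComplexOrder

/-- The eigenvalue vector of a Hermitian matrix depends only on its characteristic polynomial. -/
theorem specVec_eq_of_charpoly_eq {n : ℕ} {X Y : Matrix (Fin n) (Fin n) ℂ}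
    (hX : X.IsHermitian) (hY : Y.IsHermitian) (h : X.charpoly = Y.charpoly) :
    specVec X = specVec Y := by
  rw [specVec, specVec, dif_pos hX, dif_pos hY, (hX.eigenvalues_eq_eigenvalues_iff hY).mpr h]

theorem charpoly_diagonal_single_eq {n : ℕ} (i j : Fin n) :
    (diagonal (Pi.single i (1 : ℂ))).charpoly = (diagonal (Pi.single j (1 : ℂ))).charpoly := by
  rw [charpoly_diagonal, charpoly_diagonal, ← Equiv.prod_comp (Equiv.swap i j)]
  refine Finset.prod_congr rfl fun k _ => ?_
  congr 2
  simp only [Pi.single_apply, Equiv.swap_apply_eq_iff, Equiv.swap_apply_left]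

/-- The orthogonal projection onto the line spanned by the `i`-th eigenvector of `B`. -/
noncomputable def eigenprojection {n : ℕ} {B : Matrix (Fin n) (Fin n) ℂ} (hB : B.IsHermitian)
    (i : Fin n) : Matrix (Fin n) (Fin n) ℂ :=
  Unitary.conjStarAlgAut ℂ _ hB.eigenvectorUnitary (diagonal (Pi.single i 1))

theorem isHermitian_eigenprojection {n : ℕ} {B : Matrix (Fin n) (Fin n) ℂ} (hB : B.IsHermitian)
    (i : Fin n) : (eigenprojection hB i).IsHermitian := by
  have h : (diagonal (Pi.single i (1 : ℂ))).IsHermitian := by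
    rw [isHermitian_diagonal_iff]
    intro j
    by_cases hj : j = i <;> simp [hj, IsSelfAdjoint]
  exact IsSelfAdjoint.map (show IsSelfAdjoint _ from h) _

theorem charpoly_eigenprojection {n : ℕ} {B : Matrix (Fin n) (Fin n) ℂ} (hB : B.IsHermitian)
    (i : Fin n) : (eigenprojection hB i).charpoly = (diagonal (Pi.single i (1 : ℂ))).charpoly := by
  rw [eigenprojection, Unitary.conjStarAlgAut_apply, charpoly_mul_comm, ← mul_assoc]
  simp

theorem trace_eigenprojection_mul {n : ℕ} {B : Matrix (Fin n) (Fin n) ℂ} (hB : B.IsHermitian)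
    (i : Fin n) : (eigenprojection hB i * B).trace = hB.eigenvalues i := by
  have h : eigenprojection hB i * B = Unitary.conjStarAlgAut ℂ _ hB.eigenvectorUnitary
      (diagonal (Pi.single i 1) * diagonal (RCLike.ofReal ∘ hB.eigenvalues)) := by
    rw [map_mul, ← hB.spectral_theorem, eigenprojection]
  rw [h, Unitary.conjStarAlgAut_apply, trace_mul_comm, ← mul_assoc]
  simp [diagonal_mul_diagonal, trace_diagonal, Pi.single_apply]

theorem strongly_operator_commuting_with_all_is_multiple_of_id (n : ℕ)
    (B : Matrix (Fin n) (Fin n) ℂ) (hB : B.IsHermitian)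
    (h : ∀ X : Matrix (Fin n) (Fin n) ℂ, X.IsHermitian →
      Matrix.trace (X * B) = ((∑ i, specVec X i * specVec B i : ℝ) : ℂ)) :
    ∃ t : ℝ, B = t • (1 : Matrix (Fin n) (Fin n) ℂ) := by
  have key (i j : Fin n) : hB.eigenvalues i = hB.eigenvalues j := by
    have hs : specVec (eigenprojection hB i) = specVec (eigenprojection hB j) :=
      specVec_eq_of_charpoly_eq (isHermitian_eigenprojection hB i)
        (isHermitian_eigenprojection hB j) <| by
          rw [charpoly_eigenprojection, charpoly_eigenprojection, charpoly_diagonal_single_eq]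
    have ht := h _ (isHermitian_eigenprojection hB i)
    rw [hs, ← h _ (isHermitian_eigenprojection hB j), trace_eigenprojection_mul,
      trace_eigenprojection_mul] at ht
    exact_mod_cast ht
  rcases isEmpty_or_nonempty (Fin n) with _ | ⟨⟨i⟩⟩
  · exact ⟨0, Subsingleton.elim _ _⟩
  · refine ⟨hB.eigenvalues i, ?_⟩
    have hd : diagonal (RCLike.ofReal ∘ hB.eigenvalues) =
        (hB.eigenvalues i : ℂ) • (1 : Matrix (Fin n) (Fin n) ℂ) := by
      rw [smul_one_eq_diagonal]
      exact congrArg diagonal (funext fun j => by simp [key j i])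
    conv_lhs => rw [hB.spectral_theorem, hd, map_smul, map_one]
    exact Complex.coe_smul _ _
end

section
/- Let T₁, T₂ : ℋⁿ → ℋⁿ be ℝ-linear maps with least vectors q₁ and q₂ respectively, and let q be the least vector of the composition T₁∘T₂. Then q ≺_w q₁*q₂. -/
open Matrix
open scoped ComplexOrder

/-- Extension of a vector by zero to a sequence. -/
noncomputable def zeroExtend {n : ℕ} (p : Fin n → ℝ) : ℕ → ℝ :=
  fun i => if h : i < n then p ⟨i, h⟩ else 0

lemma zeroExtend_val {n : ℕ} (p : Fin n → ℝ) (i : Fin n) : zeroExtend p i = p i := by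
  simp [zeroExtend]

lemma zeroExtend_mul {n : ℕ} (p q : Fin n → ℝ) (i : ℕ) :
    zeroExtend (p * q) i = zeroExtend p i * zeroExtend q i := by
  unfold zeroExtend
  split_ifs <;> simp

lemma DecrNonneg.zeroExtend_nonneg {n : ℕ} {p : Fin n → ℝ} (hp : DecrNonneg p) (i : ℕ) :
    0 ≤ zeroExtend p i := by
  unfold zeroExtend
  split_ifs
  exacts [hp.2 _, le_rfl]

lemma DecrNonneg.zeroExtend_antitone {n : ℕ} {p : Fin n → ℝ} (hp : DecrNonneg p) :
    Antitone (zeroExtend p) := by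
  intro i j hij
  by_cases hj : j < n
  · have hi : i < n := hij.trans_lt hj
    simpa [zeroExtend, hi, hj] using hp.1 (show (⟨i, hi⟩ : Fin n) ≤ ⟨j, hj⟩ from hij)
  · simpa [zeroExtend, hj] using hp.zeroExtend_nonneg i

lemma DecrNonneg.mul {n : ℕ} {p q : Fin n → ℝ} (hp : DecrNonneg p) (hq : DecrNonneg q) :
    DecrNonneg (p * q) :=
  ⟨fun i j hij => mul_le_mul (hp.1 hij) (hq.1 hij) (hq.2 j) (hp.2 i),
    fun i => mul_nonneg (hp.2 i) (hq.2 i)⟩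

lemma decrRearrange_decrNonneg {n : ℕ} {p : Fin n → ℝ} (hp : ∀ i, 0 ≤ p i) :
    DecrNonneg (decrRearrange p) :=
  ⟨fun _ _ hij => Tuple.monotone_sort p (Fin.rev_le_rev.2 hij), fun _ => hp _⟩

lemma absSpecVec_decrNonneg {n : ℕ} (X : Matrix (Fin n) (Fin n) ℂ) :
    DecrNonneg (absSpecVec X) := by
  unfold absSpecVec
  split_ifs with h
  · exact decrRearrange_decrNonneg fun i => abs_nonneg _
  · exact ⟨fun _ _ _ => le_rfl, fun _ => le_rfl⟩

lemma Antitone.sum_le_sum_range_card {f : ℕ → ℝ} (hf : Antitone f) (s : Finset ℕ) :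
    ∑ i ∈ s, f i ≤ ∑ i ∈ Finset.range s.card, f i := by
  set t := Finset.range s.card with ht
  have hcard : (s \ t).card = (t \ s).card :=
    Finset.card_sdiff_comm (by simp [ht])
  have hs : ∑ i ∈ s \ t, f i ≤ (s \ t).card • f s.card :=
    Finset.sum_le_card_nsmul _ _ _ fun i hi => hf (by simp [ht] at hi; exact hi.2)
  have ht' : (t \ s).card • f s.card ≤ ∑ i ∈ t \ s, f i :=
    Finset.card_nsmul_le_sum _ _ _ fun i hi => hf (by simp [ht] at hi; exact hi.1.le)
  rw [hcard] at hs
  rw [← Finset.sum_inter_add_sum_sdiff s t f, ← Finset.sum_inter_add_sum_sdiff t s f,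
    Finset.inter_comm t s]
  linarith

lemma DecrNonneg.sumLargest_eq {n : ℕ} {p : Fin n → ℝ} (hp : DecrNonneg p) {k : ℕ} (hk : k ≤ n) :
    sumLargest p k = ∑ i ∈ Finset.range k, zeroExtend p i := by
  refine IsGreatest.csSup_eq ⟨⟨Finset.univ.map (Fin.castLEEmb hk), by simp, ?_⟩, ?_⟩
  · simp only [Finset.sum_map, ← Fin.sum_univ_eq_sum_range]
    exact Finset.sum_congr rfl fun i _ => (zeroExtend_val p (Fin.castLE hk i)).symm
  · rintro _ ⟨A, rfl, rfl⟩
    simpa [zeroExtend_val] using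
      hp.zeroExtend_antitone.sum_le_sum_range_card (A.map Fin.valEmbedding)

lemma Antitone.mul_sum_le_sum_mul {c d : ℕ → ℝ} (hc : Antitone c) (m : ℕ)
    (hd : ∀ k ≤ m, 0 ≤ ∑ i ∈ Finset.range k, d i) :
    c m * ∑ i ∈ Finset.range m, d i ≤ ∑ i ∈ Finset.range m, c i * d i := by
  induction m with
  | zero => simp
  | succ m ih =>
    have h := ih fun k hk => hd k (by omega)
    have h' := mul_le_mul_of_nonneg_right (hc m.le_succ) (hd (m + 1) le_rfl)
    rw [Finset.sum_range_succ] at h' ⊢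
    rw [Finset.sum_range_succ]
    linarith

lemma WeakMaj.trans {n : ℕ} {p q r : Fin n → ℝ} (hpq : WeakMaj p q) (hqr : WeakMaj q r) :
    WeakMaj p r :=
  fun k h1 hk => (hpq k h1 hk).trans (hqr k h1 hk)

lemma WeakMaj.mul_left {n : ℕ} {a b c : Fin n → ℝ} (ha : DecrNonneg a) (hb : DecrNonneg b)
    (hc : DecrNonneg c) (hab : WeakMaj a b) : WeakMaj (c * a) (c * b) := by
  intro k _ hk
  rw [(hc.mul ha).sumLargest_eq hk, (hc.mul hb).sumLargest_eq hk]
  have hd : ∀ j ≤ k, 0 ≤ ∑ i ∈ Finset.range j, (zeroExtend b i - zeroExtend a i) := by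
    intro j hj
    rcases Nat.eq_zero_or_pos j with rfl | hpos
    · simp
    · have h := hab j hpos (hj.trans hk)
      rw [ha.sumLargest_eq (hj.trans hk), hb.sumLargest_eq (hj.trans hk)] at h
      rw [Finset.sum_sub_distrib]
      linarith
  have h := (mul_nonneg (hc.zeroExtend_nonneg k) (hd k le_rfl)).trans
    (hc.zeroExtend_antitone.mul_sum_le_sum_mul k hd)
  simp only [mul_sub, Finset.sum_sub_distrib] at h
  simp only [zeroExtend_mul]
  linarith

theorem least_vector_comp (n : ℕ) (T₁ T₂ : Matrix (Fin n) (Fin n) ℂ → Matrix (Fin n) (Fin n) ℂ)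
    (hT₁lin : IsLinearMap ℝ T₁) (hT₂lin : IsLinearMap ℝ T₂)
    (hT₁ : ∀ X : Matrix (Fin n) (Fin n) ℂ, X.IsHermitian → (T₁ X).IsHermitian)
    (hT₂ : ∀ X : Matrix (Fin n) (Fin n) ℂ, X.IsHermitian → (T₂ X).IsHermitian)
    (q₁ q₂ q : Fin n → ℝ)
    (hq₁ : IsLeastVector T₁ q₁) (hq₂ : IsLeastVector T₂ q₂)
    (hq : IsLeastVector (T₁ ∘ T₂) q) :
    WeakMaj q (q₁ * q₂) := by
  refine hq.2.2 _ (hq₁.1.mul hq₂.1) fun X hX => ?_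
  have h := (hq₂.2.1 X hX).mul_left (absSpecVec_decrNonneg _)
    (hq₂.1.mul (absSpecVec_decrNonneg X)) hq₁.1
  rw [← mul_assoc] at h
  exact (hq₁.2.1 (T₂ X) (hT₂ X hX)).trans h
end
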